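/- arXiv:1803.08864 — 3 statements merged into one kernel-verified Lean document; each statement's English description precedes it below -/
import Mathlib

section
/- Let h > 0 and let k : ℤ × ℤ → ℝ be a strictly positive coefficient field. Define the fine-grid five-point operator L_h acting on functions u : ℤ × ℤ → ℝ by (L_h u)(i,j) = c(i,j) u(i,j) + w(i,j) u(i-1,j) + e(i,j) u(i+1,j) + s(i,j) u(i,j-1) + n(i,j) u(i,j+1), where w(i,j) = -(2/h²)·k(i,j)k(i-1,j)/(k(i,j)+k(i-1,j)), e(i,j) = -(2/h²)·k(i,j)k(i+1,j)/(k(i,j)+k(i+1,j)), s(i,j) = -(2/h²)·k(i,j)k(i,j-1)/(k(i,j)+k(i,j-1)), n(i,j) = -(2/h²)·k(i,j)k(i,j+1)/(k(i,j)+k(i,j+1)), and c(i,j) = -(w(i,j)+e(i,j)+s(i,j)+n(i,j)). Let P be the piecewise constant prolongation, (P u)(i,j) = u(⌈i/2⌉, ⌈j/2⌉), and let R be its scaled adjoint, (R v)(I,J) = (1/4)·(v(2I,2J) + v(2I-1,2J) + v(2I,2J-1) + v(2I-1,2J-1)). Then for every coarse-grid function u : ℤ × ℤ → ℝ and every (I,J)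 ∈ ℤ × ℤ, (1/2)·(R (L_h (P u)))(I,J) = c'(I,J) u(I,J) + w'(I,J) u(I-1,J) + e'(I,J) u(I+1,J) + s'(I,J) u(I,J-1) + n'(I,J) u(I,J+1), where w'(I,J) = (1/8)(w(2I-1,2J) + w(2I-1,2J-1)), e'(I,J) = (1/8)(e(2I,2J) + e(2I,2J-1)), s'(I,J) = (1/8)(s(2I,2J-1) + s(2I-1,2J-1)), n'(I,J) = (1/8)(n(2I-1,2J) + n(2I,2J)), and c'(I,J) = -(w'(I,J) + e'(I,J) + s'(I,J) + n'(I,J)). -/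
/-- The fine cells `2 * m - 1` and `2 * m` both lie in the coarse cell `m`. -/
theorem ceil_intCast_div_two_eq {i m : ℤ} (h₁ : 2 * m - 1 ≤ i) (h₂ : i ≤ 2 * m) :
    ⌈(i : ℚ) / 2⌉ = m := by
  have h₁' : (2 * m - 1 : ℚ) ≤ i := by exact_mod_cast h₁
  have h₂' : (i : ℚ) ≤ 2 * m := by exact_mod_cast h₂
  rw [Int.ceil_eq_iff]
  constructor <;> linarith

/-- Proposition 1 (infinite-grid version): the Galerkin coarse-grid operator
`(1/2) R ∘ L_h ∘ P` for the cell-centered finite volume five-point operator,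
piecewise constant prolongation `P` and its scaled adjoint `R`, is a five-point
operator whose coefficients are `(1/8)`-scaled sums of fine-grid coefficients. -/
theorem stmt0
    (h : ℝ) (hh : 0 < h)
    (k : ℤ × ℤ → ℝ) (hk : ∀ p, 0 < k p)
    (w e s n c : ℤ × ℤ → ℝ)
    (hw : ∀ i j : ℤ, w (i, j) =
      -(2 / h ^ 2) * (k (i, j) * k (i - 1, j) / (k (i, j) + k (i - 1, j))))
    (he : ∀ i j : ℤ, e (i, j) =
      -(2 / h ^ 2) * (k (i, j) * k (i + 1, j) / (k (i, j) + k (i + 1, j))))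
    (hs : ∀ i j : ℤ, s (i, j) =
      -(2 / h ^ 2) * (k (i, j) * k (i, j - 1) / (k (i, j) + k (i, j - 1))))
    (hn : ∀ i j : ℤ, n (i, j) =
      -(2 / h ^ 2) * (k (i, j) * k (i, j + 1) / (k (i, j) + k (i, j + 1))))
    (hc : ∀ i j : ℤ, c (i, j) = -(w (i, j) + e (i, j) + s (i, j) + n (i, j)))
    (L P R : ((ℤ × ℤ) → ℝ) → ((ℤ × ℤ) → ℝ))
    (hL : ∀ (u : (ℤ × ℤ) → ℝ) (i j : ℤ), L u (i, j) =
      c (i, j) * u (i, j) + w (i, j) * u (i - 1, j) + e (i, j) * u (i + 1, j)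
        + s (i, j) * u (i, j - 1) + n (i, j) * u (i, j + 1))
    (hP : ∀ (u : (ℤ × ℤ) → ℝ) (i j : ℤ), P u (i, j) = u (⌈(i : ℚ) / 2⌉, ⌈(j : ℚ) / 2⌉))
    (hR : ∀ (v : (ℤ × ℤ) → ℝ) (I J : ℤ), R v (I, J) =
      (1 / 4) * (v (2 * I, 2 * J) + v (2 * I - 1, 2 * J) + v (2 * I, 2 * J - 1)
        + v (2 * I - 1, 2 * J - 1)))
    (w' e' s' n' c' : ℤ × ℤ → ℝ)
    (hw' : ∀ I J : ℤ, w' (I, J) = (1 / 8) * (w (2 * I - 1, 2 * J) + w (2 * I - 1, 2 * J - 1)))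
    (he' : ∀ I J : ℤ, e' (I, J) = (1 / 8) * (e (2 * I, 2 * J) + e (2 * I, 2 * J - 1)))
    (hs' : ∀ I J : ℤ, s' (I, J) = (1 / 8) * (s (2 * I, 2 * J - 1) + s (2 * I - 1, 2 * J - 1)))
    (hn' : ∀ I J : ℤ, n' (I, J) = (1 / 8) * (n (2 * I - 1, 2 * J) + n (2 * I, 2 * J)))
    (hc' : ∀ I J : ℤ, c' (I, J) = -(w' (I, J) + e' (I, J) + s' (I, J) + n' (I, J))) :
    ∀ (u : (ℤ × ℤ) → ℝ) (I J : ℤ),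
      (1 / 2) * R (L (P u)) (I, J) =
        c' (I, J) * u (I, J) + w' (I, J) * u (I - 1, J) + e' (I, J) * u (I + 1, J)
          + s' (I, J) * u (I, J - 1) + n' (I, J) * u (I, J + 1) := by
  intro u I J
  have even (m : ℤ) : ⌈((2 * m : ℤ) : ℚ) / 2⌉ = m :=
    ceil_intCast_div_two_eq (by lia) (by lia)
  have odd (m : ℤ) : ⌈((2 * m - 1 : ℤ) : ℚ) / 2⌉ = m :=
    ceil_intCast_div_two_eq (by lia) (by lia)
  have next (m : ℤ) : ⌈((2 * m + 1 : ℤ) : ℚ) / 2⌉ = m + 1 :=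
    ceil_intCast_div_two_eq (by lia) (by lia)
  have prev (m : ℤ) : ⌈((2 * m - 1 - 1 : ℤ) : ℚ) / 2⌉ = m - 1 :=
    ceil_intCast_div_two_eq (by lia) (by lia)
  simp only [hR, hL, hP, sub_add_cancel, even, odd, next, prev, hc, hc', hw', he', hs', hn']
  ring
end

section
/- Let h > 0 and let k : ℤ × ℤ → ℝ be strictly positive. For a,b > 0 write HM(a,b) = 2ab/(a+b) for the harmonic mean and AM(a,b) = (a+b)/2 for the arithmetic mean. Let L_h, P, R be as follows: (L_h u)(i,j) = c(i,j)u(i,j) + w(i,j)u(i-1,j) + e(i,j)u(i+1,j) + s(i,j)u(i,j-1) + n(i,j)u(i,j+1) with w(i,j) = -(1/h²)·HM(k(i,j),k(i-1,j)) and similarly for e, s, n (using the neighbor in the corresponding direction), c(i,j) = -(w+e+s+n)(i,j); (P u)(i,j) = u(⌈i/2⌉,⌈j/2⌉); (R v)(I,J) = (1/4)(v(2I,2J)+v(2I-1,2J)+v(2I,2J-1)+v(2I-1,2J-1)). Then the west coefficient of the Galerkin operator (1/2) R L_h P at coarse cell (I,J) equals -(1/(2h)²)·AM( HM(k(2I-1,2J),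 k(2I-2,2J)), HM(k(2I-1,2J-1), k(2I-2,2J-1)) ), i.e. the Galerkin west coefficient is exactly the coefficient of a direct cell-centered finite volume discretization on the grid of mesh size 2h in which the diffusion coefficient on a coarse edge is the arithmetic average of the two fine-grid harmonic-average edge coefficients lying on that edge; the analogous identities hold for the east, south and north coefficients. -/
/-- Harmonic mean. -/
noncomputable def HM (a b : ℝ) : ℝ := 2 * a * b / (a + b)

/-- Arithmetic mean. -/
noncomputable def AM (a b : ℝ) : ℝ := (a + b) / 2

/-- The Kronecker delta grid function centered at `p`. -/
def delta (p : ℤ × ℤ) : (ℤ × ℤ) → ℝ := fun q => if q = p then 1 else 0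

theorem Int.ceil_half_eq {i a : ℤ} (h₁ : 2 * a - 1 ≤ i) (h₂ : i ≤ 2 * a) :
    ⌈(i : ℚ) / 2⌉ = a := by
  have h₁' : (2 * a - 1 : ℚ) ≤ i := by exact_mod_cast h₁
  have h₂' : (i : ℚ) ≤ 2 * a := by exact_mod_cast h₂
  rw [Int.ceil_eq_iff]
  constructor <;> linarith

/-- Interpretation of Proposition 1: the coefficients of the Galerkin coarse-grid
operator `(1/2) R ∘ L_h ∘ P` coincide with those of a direct cell-centered finite
volume discretization on the grid of mesh size `2h` in which the diffusion
coefficient on a coarse edge is the arithmetic average of the two fine-grid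
harmonic-average edge coefficients lying on that edge. -/
theorem stmt1
    (h : ℝ) (hh : 0 < h)
    (k : ℤ × ℤ → ℝ) (hk : ∀ p, 0 < k p)
    (w e s n c : ℤ × ℤ → ℝ)
    (hw : ∀ i j : ℤ, w (i, j) = -(1 / h ^ 2) * HM (k (i, j)) (k (i - 1, j)))
    (he : ∀ i j : ℤ, e (i, j) = -(1 / h ^ 2) * HM (k (i, j)) (k (i + 1, j)))
    (hs : ∀ i j : ℤ, s (i, j) = -(1 / h ^ 2) * HM (k (i, j)) (k (i, j - 1)))
    (hn : ∀ i j : ℤ, n (i, j) = -(1 / h ^ 2) * HM (k (i, j)) (k (i, j + 1)))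
    (hc : ∀ i j : ℤ, c (i, j) = -(w (i, j) + e (i, j) + s (i, j) + n (i, j)))
    (L P R : ((ℤ × ℤ) → ℝ) → ((ℤ × ℤ) → ℝ))
    (hL : ∀ (u : (ℤ × ℤ) → ℝ) (i j : ℤ), L u (i, j) =
      c (i, j) * u (i, j) + w (i, j) * u (i - 1, j) + e (i, j) * u (i + 1, j)
        + s (i, j) * u (i, j - 1) + n (i, j) * u (i, j + 1))
    (hP : ∀ (u : (ℤ × ℤ) → ℝ) (i j : ℤ), P u (i, j) = u (⌈(i : ℚ) / 2⌉, ⌈(j : ℚ) / 2⌉))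
    (hR : ∀ (v : (ℤ × ℤ) → ℝ) (I J : ℤ), R v (I, J) =
      (1 / 4) * (v (2 * I, 2 * J) + v (2 * I - 1, 2 * J) + v (2 * I, 2 * J - 1)
        + v (2 * I - 1, 2 * J - 1))) :
    ∀ I J : ℤ,
      -- west coefficient
      (1 / 2) * R (L (P (delta (I - 1, J)))) (I, J) =
        -(1 / (2 * h) ^ 2) * AM (HM (k (2 * I - 1, 2 * J)) (k (2 * I - 2, 2 * J)))
          (HM (k (2 * I - 1, 2 * J - 1)) (k (2 * I - 2, 2 * J - 1))) ∧
      -- east coefficient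
      (1 / 2) * R (L (P (delta (I + 1, J)))) (I, J) =
        -(1 / (2 * h) ^ 2) * AM (HM (k (2 * I, 2 * J)) (k (2 * I + 1, 2 * J)))
          (HM (k (2 * I, 2 * J - 1)) (k (2 * I + 1, 2 * J - 1))) ∧
      -- south coefficient
      (1 / 2) * R (L (P (delta (I, J - 1)))) (I, J) =
        -(1 / (2 * h) ^ 2) * AM (HM (k (2 * I, 2 * J - 1)) (k (2 * I, 2 * J - 2)))
          (HM (k (2 * I - 1, 2 * J - 1)) (k (2 * I - 1, 2 * J - 2))) ∧
      -- north coefficient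
      (1 / 2) * R (L (P (delta (I, J + 1)))) (I, J) =
        -(1 / (2 * h) ^ 2) * AM (HM (k (2 * I - 1, 2 * J)) (k (2 * I - 1, 2 * J + 1)))
          (HM (k (2 * I, 2 * J)) (k (2 * I, 2 * J + 1))) := by
  intro I J
  have even (a : ℤ) : ⌈((2 * a : ℤ) : ℚ) / 2⌉ = a :=
    Int.ceil_half_eq (by lia) (by lia)
  have even_sub_one (a : ℤ) : ⌈((2 * a - 1 : ℤ) : ℚ) / 2⌉ = a :=
    Int.ceil_half_eq (by lia) (by lia)
  have even_sub_two (a : ℤ) : ⌈((2 * a - 1 - 1 : ℤ) : ℚ) / 2⌉ = a - 1 :=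
    Int.ceil_half_eq (by lia) (by lia)
  have even_add_one (a : ℤ) : ⌈((2 * a + 1 : ℤ) : ℚ) / 2⌉ = a + 1 :=
    Int.ceil_half_eq (by lia) (by lia)
  have sub_two (a : ℤ) : 2 * a - 2 = 2 * a - 1 - 1 := by ring
  have sub_ne (a : ℤ) : a ≠ a - 1 := by lia
  have add_ne (a : ℤ) : a ≠ a + 1 := by lia
  have sub_ne_add (a : ℤ) : a - 1 ≠ a + 1 := by lia
  simp only [hR, hL, hP, sub_add_cancel, even, even_sub_one, even_sub_two, even_add_one,
    sub_two, delta, Prod.mk.injEq, sub_ne, add_ne, sub_ne_add, (sub_ne_add _).symm,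
    (sub_ne _).symm, (add_ne _).symm, and_true, and_false, and_self,
    if_true, if_false, hw, he, hs, hn, AM]
  refine ⟨?_, ?_, ?_, ?_⟩ <;> ring
end

section
/- Let h > 0 and θ = (θ₁,θ₂) ∈ ℝ². For a,b ∈ {0,1} define ψ^{ab}_θ : ℤ × ℤ → ℂ by ψ^{ab}_θ(j₁,j₂) = exp(i(θ₁ j₁ + θ₂ j₂)h) if j₁ ≡ a and j₂ ≡ b (mod 2), and 0 otherwise, and let L_h be the five-point discrete Laplacian (L_h u)(j₁,j₂) = (1/h²)(4u(j₁,j₂) - u(j₁-1,j₂) - u(j₁+1,j₂) - u(j₁,j₂-1) - u(j₁,j₂+1)). Then, writing c₁ = cos(θ₁ h) and c₂ = cos(θ₂ h): L_h ψ^{00}_θ = (1/h²)(4ψ^{00}_θ - 2c₁ψ^{10}_θ - 2c₂ψ^{01}_θ), L_h ψ^{11}_θ = (1/h²)(4ψ^{11}_θ - 2c₁ψ^{01}_θ - 2c₂ψ^{10}_θ), L_h ψ^{10}_θ = (1/h²)(4ψ^{10}_θ - 2c₁ψ^{00}_θ - 2c₂ψ^{11}_θ), and L_h ψ^{01}_θ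 = (1/h²)(4ψ^{01}_θ - 2c₁ψ^{11}_θ - 2c₂ψ^{00}_θ). In particular, the four-dimensional space span{ψ^{00}_θ, ψ^{11}_θ, ψ^{10}_θ, ψ^{01}_θ} is invariant under L_h. -/
open Complex

/-- A plane wave summed over the two neighbours of a point along one axis. -/
lemma exp_I_mul_sub_add_exp_I_mul_add (z t : ℂ) :
    exp (I * (z - t)) + exp (I * (z + t)) = 2 * cos t * exp (I * z) := by
  rw [two_cos, mul_sub, mul_add, sub_eq_add_neg, exp_add, exp_add, mul_comm t, neg_mul, mul_comm t]
  ring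

/-- The five-point stencil applied to the restriction of a plane wave to the points with index
parities `(a, b)`, at a grid point. -/
lemma fivePoint_parity_mode (h θ₁ θ₂ : ℝ) {a b a' b' : ℤ}
    (ha : a = 0 ∧ a' = 1 ∨ a = 1 ∧ a' = 0) (hb : b = 0 ∧ b' = 1 ∨ b = 1 ∧ b' = 0)
    {u v w : ℤ × ℤ → ℂ}
    (hu : ∀ j₁ j₂ : ℤ, u (j₁, j₂) =
      if j₁ % 2 = a ∧ j₂ % 2 = b then exp (I * ((θ₁ * j₁ + θ₂ * j₂) * h)) else 0)
    (hv : ∀ j₁ j₂ : ℤ, v (j₁, j₂) =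
      if j₁ % 2 = a' ∧ j₂ % 2 = b then exp (I * ((θ₁ * j₁ + θ₂ * j₂) * h)) else 0)
    (hw : ∀ j₁ j₂ : ℤ, w (j₁, j₂) =
      if j₁ % 2 = a ∧ j₂ % 2 = b' then exp (I * ((θ₁ * j₁ + θ₂ * j₂) * h)) else 0)
    (j₁ j₂ : ℤ) :
    4 * u (j₁, j₂) - u (j₁ - 1, j₂) - u (j₁ + 1, j₂) - u (j₁, j₂ - 1) - u (j₁, j₂ + 1) =
      4 * u (j₁, j₂) - 2 * Real.cos (θ₁ * h) * v (j₁, j₂)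
        - 2 * Real.cos (θ₂ * h) * w (j₁, j₂) := by
  have h₁ : u (j₁ - 1, j₂) + u (j₁ + 1, j₂) = 2 * Real.cos (θ₁ * h) * v (j₁, j₂) := by
    have hm : (j₁ - 1) % 2 = a ↔ j₁ % 2 = a' := by omega
    have hp : (j₁ + 1) % 2 = a ↔ j₁ % 2 = a' := by omega
    simp only [hu, hv, hm, hp]
    split_ifs
    · push_cast
      rw [← exp_I_mul_sub_add_exp_I_mul_add]
      ring_nf
    · simp
  have h₂ : u (j₁, j₂ - 1) + u (j₁, j₂ + 1) = 2 * Real.cos (θ₂ * h) * w (j₁, j₂) := by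
    have hm : (j₂ - 1) % 2 = b ↔ j₂ % 2 = b' := by omega
    have hp : (j₂ + 1) % 2 = b ↔ j₂ % 2 = b' := by omega
    simp only [hu, hw, hm, hp]
    split_ifs
    · push_cast
      rw [← exp_I_mul_sub_add_exp_I_mul_add]
      ring_nf
    · simp
  linear_combination -h₁ - h₂

/-- A combination of three members of a submodule of functions, in pointwise form. -/
lemma fun_mul_sub_sub_mem {α : Type*} {S : Submodule ℂ (α → ℂ)} {u v w : α → ℂ}
    (hu : u ∈ S) (hv : v ∈ S) (hw : w ∈ S) (k p q r : ℂ) :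
    (fun j => k * (p * u j - q * v j - r * w j)) ∈ S :=
  S.smul_mem k (S.sub_mem (S.sub_mem (S.smul_mem p hu) (S.smul_mem q hv)) (S.smul_mem r hw))

/-- The Fourier representation of the five-point Laplacian with respect to the
non-standard LFA basis `{ψ^{00}, ψ^{11}, ψ^{10}, ψ^{01}}` (at frozen frequency θ),
and the resulting invariance of the spanned subspace under `L_h`. -/
theorem stmt6
    (h : ℝ) (hh : 0 < h) (θ₁ θ₂ : ℝ)
    (ψ00 ψ11 ψ10 ψ01 : ℤ × ℤ → ℂ)
    (hψ00 : ∀ j₁ j₂ : ℤ, ψ00 (j₁, j₂) =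
      if j₁ % 2 = 0 ∧ j₂ % 2 = 0 then Complex.exp (Complex.I * ((θ₁ * j₁ + θ₂ * j₂) * h)) else 0)
    (hψ11 : ∀ j₁ j₂ : ℤ, ψ11 (j₁, j₂) =
      if j₁ % 2 = 1 ∧ j₂ % 2 = 1 then Complex.exp (Complex.I * ((θ₁ * j₁ + θ₂ * j₂) * h)) else 0)
    (hψ10 : ∀ j₁ j₂ : ℤ, ψ10 (j₁, j₂) =
      if j₁ % 2 = 1 ∧ j₂ % 2 = 0 then Complex.exp (Complex.I * ((θ₁ * j₁ + θ₂ * j₂) * h)) else 0)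
    (hψ01 : ∀ j₁ j₂ : ℤ, ψ01 (j₁, j₂) =
      if j₁ % 2 = 0 ∧ j₂ % 2 = 1 then Complex.exp (Complex.I * ((θ₁ * j₁ + θ₂ * j₂) * h)) else 0)
    (L : ((ℤ × ℤ) → ℂ) → ((ℤ × ℤ) → ℂ))
    (hL : ∀ (u : (ℤ × ℤ) → ℂ) (j₁ j₂ : ℤ), L u (j₁, j₂) =
      (1 / (h : ℂ) ^ 2) * (4 * u (j₁, j₂) - u (j₁ - 1, j₂) - u (j₁ + 1, j₂)
        - u (j₁, j₂ - 1) - u (j₁, j₂ + 1))) :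
    (L ψ00 = fun j => (1 / (h : ℂ) ^ 2) *
      (4 * ψ00 j - 2 * Real.cos (θ₁ * h) * ψ10 j - 2 * Real.cos (θ₂ * h) * ψ01 j)) ∧
    (L ψ11 = fun j => (1 / (h : ℂ) ^ 2) *
      (4 * ψ11 j - 2 * Real.cos (θ₁ * h) * ψ01 j - 2 * Real.cos (θ₂ * h) * ψ10 j)) ∧
    (L ψ10 = fun j => (1 / (h : ℂ) ^ 2) *
      (4 * ψ10 j - 2 * Real.cos (θ₁ * h) * ψ00 j - 2 * Real.cos (θ₂ * h) * ψ11 j)) ∧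
    (L ψ01 = fun j => (1 / (h : ℂ) ^ 2) *
      (4 * ψ01 j - 2 * Real.cos (θ₁ * h) * ψ11 j - 2 * Real.cos (θ₂ * h) * ψ00 j)) ∧
    (∀ u : (ℤ × ℤ) → ℂ,
      u ∈ Submodule.span ℂ ({ψ00, ψ11, ψ10, ψ01} : Set ((ℤ × ℤ) → ℂ)) →
      L u ∈ Submodule.span ℂ ({ψ00, ψ11, ψ10, ψ01} : Set ((ℤ × ℤ) → ℂ))) := by
  have e00 : L ψ00 = fun j => (1 / (h : ℂ) ^ 2) *
      (4 * ψ00 j - 2 * Real.cos (θ₁ * h) * ψ10 j - 2 * Real.cos (θ₂ * h) * ψ01 j) := by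
    ext ⟨j₁, j₂⟩
    rw [hL, fivePoint_parity_mode h θ₁ θ₂ (by simp) (by simp) hψ00 hψ10 hψ01]
  have e11 : L ψ11 = fun j => (1 / (h : ℂ) ^ 2) *
      (4 * ψ11 j - 2 * Real.cos (θ₁ * h) * ψ01 j - 2 * Real.cos (θ₂ * h) * ψ10 j) := by
    ext ⟨j₁, j₂⟩
    rw [hL, fivePoint_parity_mode h θ₁ θ₂ (by simp) (by simp) hψ11 hψ01 hψ10]
  have e10 : L ψ10 = fun j => (1 / (h : ℂ) ^ 2) *
      (4 * ψ10 j - 2 * Real.cos (θ₁ * h) * ψ00 j - 2 * Real.cos (θ₂ * h) * ψ11 j) := by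
    ext ⟨j₁, j₂⟩
    rw [hL, fivePoint_parity_mode h θ₁ θ₂ (by simp) (by simp) hψ10 hψ00 hψ11]
  have e01 : L ψ01 = fun j => (1 / (h : ℂ) ^ 2) *
      (4 * ψ01 j - 2 * Real.cos (θ₁ * h) * ψ11 j - 2 * Real.cos (θ₂ * h) * ψ00 j) := by
    ext ⟨j₁, j₂⟩
    rw [hL, fivePoint_parity_mode h θ₁ θ₂ (by simp) (by simp) hψ01 hψ11 hψ00]
  refine ⟨e00, e11, e10, e01, fun u hu => ?_⟩
  let T : (ℤ × ℤ → ℂ) →ₗ[ℂ] (ℤ × ℤ → ℂ) :=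
    { toFun := L
      map_add' := fun u v => by
        ext ⟨j₁, j₂⟩
        simp only [hL, Pi.add_apply]
        ring
      map_smul' := fun c u => by
        ext ⟨j₁, j₂⟩
        simp only [hL, Pi.smul_apply, smul_eq_mul, RingHom.id_apply]
        ring }
  set S := Submodule.span ℂ ({ψ00, ψ11, ψ10, ψ01} : Set ((ℤ × ℤ) → ℂ))
  have m00 : ψ00 ∈ S := Submodule.subset_span (by simp)
  have m11 : ψ11 ∈ S := Submodule.subset_span (by simp)
  have m10 : ψ10 ∈ S := Submodule.subset_span (by simp)
  have m01 : ψ01 ∈ S := Submodule.subset_span (by simp)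
  suffices hST : S ≤ S.comap T from hST hu
  refine Submodule.span_le.2 ?_
  rintro _ (rfl | rfl | rfl | rfl)
  · exact e00.symm.subst (motive := (· ∈ S)) (fun_mul_sub_sub_mem m00 m10 m01 _ _ _ _)
  · exact e11.symm.subst (motive := (· ∈ S)) (fun_mul_sub_sub_mem m11 m01 m10 _ _ _ _)
  · exact e10.symm.subst (motive := (· ∈ S)) (fun_mul_sub_sub_mem m10 m00 m11 _ _ _ _)
  · exact e01.symm.subst (motive := (· ∈ S)) (fun_mul_sub_sub_mem m01 m11 m00 _ _ _ _)
end
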